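/- Let G be a unicyclic graph containing a cycle, let u be a vertex on the cycle with cycle-neighbors x and y, and let w, v be vertices not on the cycle with u adjacent to w, w adjacent to v, deg(w) = 2 and deg(v) ≥ 3, such that v is the only vertex of degree ≥ 3 in the tree component containing w and v obtained by deleting the edge u w. Write N(u) = {x, y, w} ∪ {u₁,…,u_n} and N(v) = {w} ∪ {v₁,…,v_m}, and suppose deg(u) ≥ deg(v) (i.e. n + 3 ≥ m + 1). Let G* be the graph obtained from G by deleting the edges v v_i and adding the edges u v_i for all 2 ≤ i ≤ m. Then SO(G*) > SO(G). -/

import Mathlib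

open SimpleGraph

/-- The Sombor index of a finite simple graph:
`SO(G) = Σ_{uv ∈ E(G)} √(d(u)² + d(v)²)`. -/
noncomputable def somborIndex {V : Type*} [Fintype V] (G : SimpleGraph V) : ℝ :=
  letI := Classical.decEq V
  letI : DecidableRel G.Adj := Classical.decRel _
  ∑ e ∈ G.edgeFinset,
    Sym2.lift ⟨fun a b => Real.sqrt ((G.degree a : ℝ) ^ 2 + (G.degree b : ℝ) ^ 2),
      fun a b => by simp [add_comm]⟩ e

/-- A unicyclic graph: a connected graph whose number of edges equals its
number of vertices (equivalently, a connected graph with exactly one cycle). -/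
def Unicyclic {V : Type*} [Fintype V] (G : SimpleGraph V) : Prop :=
  letI := Classical.decEq V
  letI : DecidableRel G.Adj := Classical.decRel _
  G.Connected ∧ G.edgeFinset.card = Fintype.card V


lemma sqrt_gap_anti {s t d e : ℝ} (hs : 0 < s) (hst : s ≤ t) (hd : 0 ≤ d) (hde : d ≤ e) :
    √(t ^ 2 + e ^ 2) - √(s ^ 2 + e ^ 2) ≤ √(t ^ 2 + d ^ 2) - √(s ^ 2 + d ^ 2) := by
  have h1 := Real.sq_sqrt (show 0 ≤ t ^ 2 + e ^ 2 by positivity)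
  have h2 := Real.sq_sqrt (show 0 ≤ s ^ 2 + e ^ 2 by positivity)
  have h3 := Real.sq_sqrt (show 0 ≤ t ^ 2 + d ^ 2 by positivity)
  have h4 := Real.sq_sqrt (show 0 ≤ s ^ 2 + d ^ 2 by positivity)
  have h5 : √(t ^ 2 + d ^ 2) ≤ √(t ^ 2 + e ^ 2) := Real.sqrt_le_sqrt (by gcongr)
  have h6 : √(s ^ 2 + d ^ 2) ≤ √(s ^ 2 + e ^ 2) := Real.sqrt_le_sqrt (by gcongr)
  have h7 : √(s ^ 2 + e ^ 2) ≤ √(t ^ 2 + e ^ 2) := Real.sqrt_le_sqrt (by gcongr)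
  have h8 : 0 < √(s ^ 2 + d ^ 2) := Real.sqrt_pos.2 (by positivity)
  have h9 : 0 ≤ √(t ^ 2 + d ^ 2) := Real.sqrt_nonneg _
  generalize √(t ^ 2 + e ^ 2) = P at *
  generalize √(s ^ 2 + e ^ 2) = Q at *
  generalize √(t ^ 2 + d ^ 2) = p at *
  generalize √(s ^ 2 + d ^ 2) = q at *
  have k : (P - Q) * (p + q) ≤ (p - q) * (p + q) := by
    have : (P - Q) * (p + q) ≤ (P - Q) * (P + Q) :=
      mul_le_mul_of_nonneg_left (by linarith) (by linarith)
    nlinarith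
  exact le_of_mul_le_mul_right k (by linarith)

lemma mul_sqrt_mono {s t : ℝ} (hs : 0 ≤ s) (hst : s ≤ t) :
    s * √(t ^ 2 + 2 ^ 2) ≤ t * √(s ^ 2 + 2 ^ 2) := by
  have ht := hs.trans hst
  refine (sq_le_sq₀ (by positivity) (by positivity)).1 ?_
  rw [mul_pow, mul_pow, Real.sq_sqrt (by positivity), Real.sq_sqrt (by positivity)]
  nlinarith

lemma sqrt_gap_mono {a b h : ℝ} (hb : 0 ≤ b) (hh : 0 ≤ h) (hab : b + h ≤ a) :
    √((b + h) ^ 2 + 2 ^ 2) - √(b ^ 2 + 2 ^ 2) ≤ √((a + h) ^ 2 + 2 ^ 2) - √(a ^ 2 + 2 ^ 2) := by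
  have h1 := Real.sq_sqrt (show 0 ≤ (a + h) ^ 2 + 2 ^ 2 by positivity)
  have h2 := Real.sq_sqrt (show 0 ≤ a ^ 2 + 2 ^ 2 by positivity)
  have h3 := Real.sq_sqrt (show 0 ≤ (b + h) ^ 2 + 2 ^ 2 by positivity)
  have h4 := Real.sq_sqrt (show 0 ≤ b ^ 2 + 2 ^ 2 by positivity)
  have m1 := mul_sqrt_mono hb (show b ≤ a by linarith)
  have m2 := mul_sqrt_mono hb (show b ≤ a + h by linarith)
  have m3 := mul_sqrt_mono (show 0 ≤ b + h by linarith) hab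
  have m4 := mul_sqrt_mono (show 0 ≤ b + h by linarith) (show b + h ≤ a + h by linarith)
  have p1 : 0 < √((a + h) ^ 2 + 2 ^ 2) := Real.sqrt_pos.2 (by positivity)
  have p2 : 0 < √(a ^ 2 + 2 ^ 2) := Real.sqrt_pos.2 (by positivity)
  have p3 : 0 < √((b + h) ^ 2 + 2 ^ 2) := Real.sqrt_pos.2 (by positivity)
  have p4 : 0 < √(b ^ 2 + 2 ^ 2) := Real.sqrt_pos.2 (by positivity)
  generalize √((a + h) ^ 2 + 2 ^ 2) = P at *
  generalize √(a ^ 2 + 2 ^ 2) = R at *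
  generalize √((b + h) ^ 2 + 2 ^ 2) = S at *
  generalize √(b ^ 2 + 2 ^ 2) = Q at *
  have e1 : S - Q = h * (2 * b + h) / (S + Q) := by
    rw [eq_div_iff (by positivity)]; nlinarith
  have e2 : P - R = h * (2 * a + h) / (P + R) := by
    rw [eq_div_iff (by positivity)]; nlinarith
  rw [e1, e2, div_le_div_iff₀ (by positivity) (by positivity), mul_assoc, mul_assoc]
  apply mul_le_mul_of_nonneg_left _ hh
  nlinarith

lemma sombor_real_ineq (a b : ℕ) (hb : 3 ≤ b) (hab : b ≤ a) (d : ℕ) (hd : 1 ≤ d) :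
    √((a : ℝ) ^ 2 + 2 ^ 2) + √((b : ℝ) ^ 2 + 2 ^ 2) + √((b : ℝ) ^ 2 + (d : ℝ) ^ 2) <
    √(((a : ℝ) + b - 2) ^ 2 + 2 ^ 2) + √((2 : ℝ) ^ 2 + 2 ^ 2) + √((2 : ℝ) ^ 2 + (d : ℝ) ^ 2) +
      ((b : ℝ) - 2) * (√(((a : ℝ) + b - 2) ^ 2 + 2 ^ 2) - √((b : ℝ) ^ 2 + 2 ^ 2)) := by
  have hd' : (1 : ℝ) ≤ d := by exact_mod_cast hd
  have hb' : (3 : ℝ) ≤ b := by exact_mod_cast hb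
  have hab' : (b : ℝ) ≤ a := by exact_mod_cast hab
  rcases hb.eq_or_lt with rfl | hb4
  · have g1 := sqrt_gap_anti (s := 2) (t := 3) (d := 1) (e := d) (by norm_num) (by norm_num)
      (by norm_num) hd'
    have g2 : √((4 : ℝ) ^ 2 + 2 ^ 2) - √((3 : ℝ) ^ 2 + 2 ^ 2) ≤
        √(((a : ℝ) + 1) ^ 2 + 2 ^ 2) - √((a : ℝ) ^ 2 + 2 ^ 2) := by
      rcases hab.eq_or_lt with rfl | h
      · norm_num
      · have h' : (4 : ℝ) ≤ a := by exact_mod_cast h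
        have := sqrt_gap_mono (a := a) (b := 3) (h := 1) (by norm_num) (by norm_num) (by linarith)
        norm_num at this ⊢
        linarith
    have g3 : √((4 : ℝ) ^ 2 + 2 ^ 2) ≤ √(((a : ℝ) + 1) ^ 2 + 2 ^ 2) := by
      apply Real.sqrt_le_sqrt
      push_cast at hab'
      nlinarith
    push_cast
    have e : (a : ℝ) + 3 - 2 = a + 1 := by ring
    rw [e]
    have n1 : √((3 : ℝ) ^ 2 + 2 ^ 2) < 3.6056 := by
      rw [Real.sqrt_lt' (by norm_num)]; norm_num
    have n2 : √((3 : ℝ) ^ 2 + 1 ^ 2) < 3.1623 := by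
      rw [Real.sqrt_lt' (by norm_num)]; norm_num
    have n3 : (4.4721 : ℝ) < √((4 : ℝ) ^ 2 + 2 ^ 2) := by
      rw [Real.lt_sqrt (by norm_num)]; norm_num
    have n4 : (2.8284 : ℝ) < √((2 : ℝ) ^ 2 + 2 ^ 2) := by
      rw [Real.lt_sqrt (by norm_num)]; norm_num
    have n5 : (2.236 : ℝ) < √((2 : ℝ) ^ 2 + 1 ^ 2) := by
      rw [Real.lt_sqrt (by norm_num)]; norm_num
    generalize √(((a : ℝ) + 1) ^ 2 + 2 ^ 2) = P at *
    generalize √((a : ℝ) ^ 2 + 2 ^ 2) = R at *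
    generalize √((3 : ℝ) ^ 2 + 2 ^ 2) = z1 at *
    generalize √((3 : ℝ) ^ 2 + 1 ^ 2) = z2 at *
    generalize √((4 : ℝ) ^ 2 + 2 ^ 2) = z3 at *
    generalize √((2 : ℝ) ^ 2 + 2 ^ 2) = z4 at *
    generalize √((2 : ℝ) ^ 2 + 1 ^ 2) = z5 at *
    generalize √((3 : ℝ) ^ 2 + (d : ℝ) ^ 2) = z6 at *
    generalize √((2 : ℝ) ^ 2 + (d : ℝ) ^ 2) = z7 at *
    clear hb' hab'
    norm_num at *
    linarith
  · have hb4' : (4 : ℝ) ≤ b := by exact_mod_cast hb4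
    have g1 := sqrt_gap_anti (s := 2) (t := b) (d := 0) (e := d) (by norm_num) (by linarith)
      le_rfl (by linarith)
    have e1 : √((b : ℝ) ^ 2 + 0 ^ 2) = b := by
      rw [zero_pow two_ne_zero, add_zero, Real.sqrt_sq (by linarith)]
    have e2 : √((2 : ℝ) ^ 2 + 0 ^ 2) = 2 := by
      rw [zero_pow two_ne_zero, add_zero, Real.sqrt_sq (by norm_num)]
    rw [e1, e2] at g1
    have g2 := sqrt_gap_mono (a := a) (b := 2) (h := b - 2) (by norm_num) (by linarith)
      (by linarith)
    have e3 : (2 : ℝ) + (b - 2) = b := by ring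
    have e4 : (a : ℝ) + (b - 2) = a + b - 2 := by ring
    rw [e3, e4] at g2
    have q : √((b : ℝ) ^ 2 + 2 ^ 2) ≤ b + 2 := by
      rw [Real.sqrt_le_left (by linarith)]; nlinarith
    have q0 : 0 ≤ √((b : ℝ) ^ 2 + 2 ^ 2) := Real.sqrt_nonneg _
    have qs := Real.sq_sqrt (show 0 ≤ (b : ℝ) ^ 2 + 2 ^ 2 by positivity)
    have ps := Real.sq_sqrt (show 0 ≤ ((a : ℝ) + b - 2) ^ 2 + 2 ^ 2 by positivity)
    have p0 : 0 ≤ √(((a : ℝ) + b - 2) ^ 2 + 2 ^ 2) := Real.sqrt_nonneg _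
    generalize √(((a : ℝ) + b - 2) ^ 2 + 2 ^ 2) = P at *
    generalize √((b : ℝ) ^ 2 + 2 ^ 2) = Q at *
    generalize √((a : ℝ) ^ 2 + 2 ^ 2) = R at *
    generalize √((2 : ℝ) ^ 2 + 2 ^ 2) = z4 at *
    generalize √((b : ℝ) ^ 2 + (d : ℝ) ^ 2) = z6 at *
    generalize √((2 : ℝ) ^ 2 + (d : ℝ) ^ 2) = z7 at *
    clear e1 e2
    have g3 : Q + (b - 2) / 2 < P := by
      refine lt_of_pow_lt_pow_left₀ 2 p0 ?_
      have : (2 * (b : ℝ) - 2) ^ 2 ≤ ((a : ℝ) + b - 2) ^ 2 := by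
        apply pow_le_pow_left₀ <;> linarith
      have k := mul_le_mul_of_nonneg_right q (show (0 : ℝ) ≤ b - 2 by linarith)
      nlinarith
    have k := mul_le_mul_of_nonneg_right (show (2 : ℝ) ≤ b - 2 by linarith)
      (show 0 ≤ P - Q by linarith)
    linarith

/-- Edge weight attached to a degree function. -/
noncomputable def sWt {V : Type*} (d : V → ℕ) : Sym2 V → ℝ :=
  Sym2.lift ⟨fun a b => Real.sqrt ((d a : ℝ) ^ 2 + (d b : ℝ) ^ 2), fun a b => by simp [add_comm]⟩

lemma sWt_mk {V : Type*} (d : V → ℕ) (a b : V) :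
    sWt d s(a, b) = √((d a : ℝ) ^ 2 + (d b : ℝ) ^ 2) := rfl

lemma sWt_le {V : Type*} {d d' : V → ℕ} {a b : V} (ha : d a ≤ d' a) (hb : d b ≤ d' b) :
    sWt d s(a, b) ≤ sWt d' s(a, b) := by
  rw [sWt_mk, sWt_mk]
  apply Real.sqrt_le_sqrt
  gcongr

lemma somborIndex_eq {V : Type*} [Fintype V] [DecidableEq V] (G : SimpleGraph V)
    [DecidableRel G.Adj] :
    somborIndex G = ∑ e ∈ G.edgeFinset, sWt (fun z => G.degree z) e := by
  unfold somborIndex sWt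
  simp only
  convert rfl

lemma prop_aux {E D T A : Prop} (h1 : T → E) (h2 : T → ¬ D) :
    (E ∧ ¬ D) ∨ A ↔ ((E ∧ ¬ (T ∨ D)) ∨ T) ∨ A := by
  tauto

lemma s2_ne_left {V : Type*} {a b c d : V} (h : a ≠ c) (h' : a ≠ d) : s(a, b) ≠ s(c, d) := by
  rw [ne_eq, Sym2.eq_iff]
  tauto

lemma s2_ne_right {V : Type*} {a b c d : V} (h : b ≠ c) (h' : b ≠ d) : s(a, b) ≠ s(c, d) := by
  rw [ne_eq, Sym2.eq_iff]
  tauto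

lemma uw_bridge {V : Type*} [Fintype V] (G : SimpleGraph V) (hG : Unicyclic G)
    {u w x : V} (c : G.Walk u u) (hc : c.IsCycle) (hx : s(u, x) ∈ c.edges)
    (hw : w ∉ c.support) (huw : G.Adj u w) :
    ¬ (G.deleteEdges {s(u, w)}).Reachable u w := by
  classical
  obtain ⟨hcon, hcard⟩ := hG
  intro hr
  have hnb : ¬ G.IsBridge s(u, w) := by
    rw [isBridge_iff]
    exact not_not.2 hr
  have h1 : (G.deleteEdges {s(u, w)}).Connected := hcon.connected_delete_edge_of_not_isBridge hnb
  have hce : ∀ e ∈ c.edges, e ∉ ({s(u, w)} : Set (Sym2 V)) := by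
    rintro e he rfl
    exact hw (c.snd_mem_support_of_mem_edges he)
  have hc' := Walk.IsCycle.toDeleteEdges _ (s := {s(u, w)}) hc hce
  have hnb2 : ¬ (G.deleteEdges {s(u, w)}).IsBridge s(u, x) := by
    intro hb
    apply hb.notMem_edges_of_isCycle hc'
    simpa [Walk.toDeleteEdges] using hx
  have h2 := (h1.connected_delete_edge_of_not_isBridge hnb2).card_vert_le_card_edgeSet_add_one
  rw [Nat.card_coe_set_eq, edgeSet_deleteEdges, edgeSet_deleteEdges,
    Set.ncard_sdiff_singleton_of_mem, Set.ncard_sdiff_singleton_of_mem] at h2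
  · have h3 : G.edgeSet.ncard = Fintype.card V := by
      rw [← hcard, ← coe_edgeFinset, Set.ncard_coe_finset]
    have h4 : 0 < Fintype.card V := Fintype.card_pos_iff.2 ⟨u⟩
    have h5 : 1 < Fintype.card V := Fintype.one_lt_card_iff.2 ⟨u, w, huw.ne⟩
    rw [h3, Nat.card_eq_fintype_card] at h2
    omega
  · exact huw
  · exact ⟨c.edges_subset_edgeSet hx, hce _ hx⟩

set_option maxHeartbeats 2000000 in
/-- Lemma 3.5(a): `u` is on the cycle with cycle-neighbours `x, y`, the tree
attached to `u` through `u ~ w ~ v` (with `deg w = 2`) has `v` as its only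
vertex of degree `≥ 3`, and `deg u ≥ deg v`.  Moving the branches
`v₂, …, v_m` of `v` over to `u` strictly increases the Sombor index. -/
theorem sombor_unicyclic_shift2_a {V : Type*} [Fintype V]
    (G : SimpleGraph V) [DecidableRel G.Adj] (hG : Unicyclic G)
    (u x y w v : V) (c : G.Walk u u) (hc : c.IsCycle)
    (hx : s(u, x) ∈ c.edges) (hy : s(u, y) ∈ c.edges) (hxy : x ≠ y)
    (hw : w ∉ c.support) (hv : v ∉ c.support)
    (huw : G.Adj u w) (hwv : G.Adj w v) (hdw : G.degree w = 2) (hdv3 : 3 ≤ G.degree v)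
    (honly : ∀ z : V, (G.deleteEdges {s(u, w)}).Reachable v z → 3 ≤ G.degree z → z = v)
    (n m : ℕ)
    (U : Fin n → V) (hUinj : Function.Injective U)
    (hU : G.neighborSet u = {x, y, w} ∪ Set.range U) (hdu : G.degree u = n + 3)
    (W : Fin m → V) (hWinj : Function.Injective W)
    (hW : G.neighborSet v = {w} ∪ Set.range W) (hdv : G.degree v = m + 1)
    (hduv : G.degree v ≤ G.degree u)
    (G' : SimpleGraph V)
    (hG' : G'.edgeSet =
      (G.edgeSet \ {e | ∃ i : Fin m, (i : ℕ) ≠ 0 ∧ e = s(v, W i)}) ∪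
        {e | ∃ i : Fin m, (i : ℕ) ≠ 0 ∧ e = s(u, W i)}) :
    somborIndex G < somborIndex G' := by
  classical
  have hbr := uw_bridge G hG c hc hx hw huw
  have huv : u ≠ v := fun h => hv (h ▸ c.start_mem_support)
  have huw' := huw.ne
  have hwv' := hwv.ne
  have hWadj : ∀ i, G.Adj v (W i) := fun i => by
    have : W i ∈ G.neighborSet v := by rw [hW]; exact Or.inr ⟨i, rfl⟩
    exact this
  have hWw : ∀ i, W i ≠ w := by
    intro i hi
    have h1 : G.neighborFinset v = Finset.univ.image W := by
      ext z
      rw [mem_neighborFinset, ← mem_neighborSet, hW]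
      simp only [Set.mem_union, Set.mem_singleton_iff, Set.mem_range, Finset.mem_image,
        Finset.mem_univ, true_and]
      constructor
      · rintro (rfl | h)
        · exact ⟨i, hi⟩
        · exact h
      · exact Or.inr
    have h2 : G.degree v ≤ m := by
      rw [← card_neighborFinset_eq_degree, h1]
      exact Finset.card_image_le.trans (by simp)
    omega
  have hWv : ∀ i, W i ≠ v := fun i => (hWadj i).ne'
  have hdel : ∀ {p q : V}, G.Adj p q → s(p, q) ≠ s(u, w) →
      (G.deleteEdges {s(u, w)}).Adj p q := by
    intro p q h h'
    rw [deleteEdges_adj]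
    exact ⟨h, h'⟩
  have hwvD : (G.deleteEdges {s(u, w)}).Adj v w := hdel hwv.symm (s2_ne_left huv.symm hwv'.symm)
  have hnuv : ¬ G.Adj u v := fun h =>
    hbr ((hdel h (s2_ne_right huv.symm hwv'.symm)).reachable.trans hwvD.reachable)
  have hWu : ∀ i, W i ≠ u := fun i h => hnuv (h ▸ (hWadj i).symm)
  have hWD : ∀ i, (G.deleteEdges {s(u, w)}).Adj v (W i) := fun i =>
    hdel (hWadj i) (s2_ne_left huv.symm hwv'.symm)
  have hnuW : ∀ i, ¬ G.Adj u (W i) := fun i h =>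
    hbr (((hdel h (s2_ne_right (hWu i) (hWw i))).reachable.trans (hWD i).symm.reachable).trans hwvD.reachable)
  have hdW : ∀ i, G.degree (W i) ≤ 2 := by
    intro i
    by_contra h
    exact hWv i (honly _ (hWD i).reachable (by omega))
  have hm : 2 ≤ m := by omega
  let i0 : Fin m := ⟨0, by omega⟩
  have hi0 : ∀ i : Fin m, (i : ℕ) ≠ 0 ↔ i ≠ i0 := by
    intro i
    simp [i0, Fin.ext_iff]
  simp only [hi0] at hG'
  clear_value i0
  have hNv : ∀ z, G.Adj v z ↔ z = w ∨ ∃ i, W i = z := by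
    intro z
    rw [← mem_neighborSet, hW]
    simp
  have hadj' : ∀ p q, G'.Adj p q ↔ (G.Adj p q ∧ ¬ ∃ i, i ≠ i0 ∧ s(p, q) = s(v, W i)) ∨
      ∃ i, i ≠ i0 ∧ s(p, q) = s(u, W i) := by
    intro p q
    rw [← mem_edgeSet, hG']
    rfl
  -- degrees in the new graph
  have hdu' : G.degree u + (m - 1) ≤ G'.degree u := by
    have hdis : Disjoint (G.neighborFinset u) ((Finset.univ.erase i0).image W) := by
      rw [Finset.disjoint_left]
      intro z hz hz'
      obtain ⟨i, -, rfl⟩ := Finset.mem_image.1 hz'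
      exact hnuW i ((mem_neighborFinset ..).1 hz)
    have hc1 : ((Finset.univ.erase i0).image W).card = m - 1 := by
      rw [Finset.card_image_of_injective _ hWinj, Finset.card_erase_of_mem (Finset.mem_univ _)]
      simp
    rw [← hc1, ← card_neighborFinset_eq_degree, ← card_neighborFinset_eq_degree,
      ← Finset.card_union_of_disjoint hdis]
    apply Finset.card_le_card
    intro z hz
    rw [mem_neighborFinset, hadj']
    rcases Finset.mem_union.1 hz with h | h
    · refine Or.inl ⟨(mem_neighborFinset ..).1 h, ?_⟩
      rintro ⟨i, -, hi⟩
      exact s2_ne_left huv (hWu i).symm hi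
    · obtain ⟨i, hi, rfl⟩ := Finset.mem_image.1 h
      exact Or.inr ⟨i, (Finset.mem_erase.1 hi).1, rfl⟩
  have hdv' : 2 ≤ G'.degree v := by
    rw [← card_neighborFinset_eq_degree, ← Finset.card_pair (hWw i0)]
    apply Finset.card_le_card
    intro z hz
    rw [mem_neighborFinset, hadj']
    left
    rw [Finset.mem_insert, Finset.mem_singleton] at hz
    rcases hz with rfl | rfl
    · refine ⟨hWadj i0, ?_⟩
      rintro ⟨i, hi, h⟩
      have h' : W i0 = W i := Sym2.congr_right.1 h
      exact hi (hWinj h').symm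
    · refine ⟨hwv.symm, ?_⟩
      rintro ⟨i, hi, h⟩
      have h' : z = W i := Sym2.congr_right.1 h
      exact hWw i h'.symm
  have hdz' : ∀ z, z ≠ v → G.degree z ≤ G'.degree z := by
    intro z hzv
    by_cases hzu : z = u
    · subst hzu; omega
    by_cases hz : ∃ i, i ≠ i0 ∧ W i = z
    · obtain ⟨i, hi, rfl⟩ := hz
      rw [← card_neighborFinset_eq_degree, ← card_neighborFinset_eq_degree]
      apply Finset.card_le_card_of_injOn (fun t => if t = v then u else t)
      · intro t ht
        have ht' : G.Adj (W i) t := by simpa using ht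
        simp only [Finset.mem_coe, mem_neighborFinset]
        split_ifs with h
        · exact (hadj' _ _).2 (Or.inr ⟨i, hi, Sym2.eq_swap⟩)
        · refine (hadj' _ _).2 (Or.inl ⟨ht', ?_⟩)
          rintro ⟨j, -, hj⟩
          have := hWv i
          rw [Sym2.eq_iff] at hj
          grind
      · intro t ht t' ht' h
        have ht1 : G.Adj (W i) t := by simpa using ht
        have ht1' : G.Adj (W i) t' := by simpa using ht'
        have hu1 : t ≠ u := by rintro rfl; exact hnuW i ht1.symm
        have hu2 : t' ≠ u := by rintro rfl; exact hnuW i ht1'.symm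
        grind
    · rw [← card_neighborFinset_eq_degree, ← card_neighborFinset_eq_degree]
      apply Finset.card_le_card
      intro t ht
      rw [mem_neighborFinset] at ht ⊢
      refine (hadj' _ _).2 (Or.inl ⟨ht, ?_⟩)
      rintro ⟨i, hi, h⟩
      apply hz
      refine ⟨i, hi, ?_⟩
      rw [Sym2.eq_iff] at h
      grind
  -- decomposition of the edge sets
  let T : Finset (Sym2 V) := {s(u, w), s(v, w), s(v, W i0)}
  let D : Finset (Sym2 V) := (Finset.univ.erase i0).image (fun i => s(v, W i))
  let A : Finset (Sym2 V) := (Finset.univ.erase i0).image (fun i => s(u, W i))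
  let R : Finset (Sym2 V) := G.edgeFinset \ (T ∪ D)
  have hWi0 : ∀ i, i ≠ i0 → W i0 ≠ W i := fun i hi h => hi (hWinj h).symm
  have hTD : Disjoint T D := by
    rw [Finset.disjoint_left]
    intro e he he'
    obtain ⟨i, hi, rfl⟩ := Finset.mem_image.1 he'
    have h1 := hWi0 i (Finset.mem_erase.1 hi).1
    have h2 := hWw i
    have h3 := hWu i
    have h4 := hWv i
    simp only [T, Finset.mem_insert, Finset.mem_singleton, Sym2.eq_iff] at he
    grind
  have hTDE : T ∪ D ⊆ G.edgeFinset := by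
    intro e he
    rw [mem_edgeFinset]
    rcases Finset.mem_union.1 he with h | h
    · simp only [T, Finset.mem_insert, Finset.mem_singleton] at h
      rcases h with rfl | rfl | rfl
      · exact huw
      · exact hwv.symm
      · exact hWadj i0
    · obtain ⟨i, hi, rfl⟩ := Finset.mem_image.1 h
      exact hWadj i
  have hE : ∑ e ∈ G.edgeFinset, sWt (fun z => G.degree z) e =
      ∑ e ∈ R, sWt (fun z => G.degree z) e + (∑ e ∈ T, sWt (fun z => G.degree z) e
        + ∑ e ∈ D, sWt (fun z => G.degree z) e) := by
    rw [← Finset.sum_union hTD, Finset.sum_sdiff hTDE]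
  have hRTA : Disjoint (R ∪ T) A := by
    rw [Finset.disjoint_left]
    intro e he he'
    obtain ⟨i, hi, rfl⟩ := Finset.mem_image.1 he'
    have hEe : s(u, W i) ∈ G.edgeFinset := by
      rcases Finset.mem_union.1 he with h | h
      · exact (Finset.mem_sdiff.1 h).1
      · exact hTDE (Finset.mem_union_left _ h)
    exact hnuW i (by simpa using hEe)
  have hRT : Disjoint R T := by
    apply Finset.disjoint_of_subset_right Finset.subset_union_left
    exact Finset.sdiff_disjoint
  have hE'set : G'.edgeFinset = (R ∪ T) ∪ A := by
    ext e
    rw [mem_edgeFinset, hG']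
    have hD : (∃ i, i ≠ i0 ∧ e = s(v, W i)) ↔ e ∈ D := by
      simp [D, eq_comm]
    have hA : (∃ i, i ≠ i0 ∧ e = s(u, W i)) ↔ e ∈ A := by
      simp [A, eq_comm]
    have hT1 : e ∈ T → e ∈ G.edgeFinset := fun h => hTDE (Finset.mem_union_left _ h)
    have hT2 : e ∈ T → e ∉ D := fun h => Finset.disjoint_left.1 hTD h
    rw [Set.mem_union, Set.mem_sdiff, Set.mem_ofPred_eq, Set.mem_ofPred_eq, hD, hA,
      ← mem_edgeFinset]
    simp only [R, Finset.mem_union, Finset.mem_sdiff]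
    exact prop_aux hT1 hT2
  have hE' : ∑ e ∈ G'.edgeFinset, sWt (fun z => G'.degree z) e =
      ∑ e ∈ R, sWt (fun z => G'.degree z) e + ∑ e ∈ T, sWt (fun z => G'.degree z) e
        + ∑ e ∈ A, sWt (fun z => G'.degree z) e := by
    rw [hE'set, Finset.sum_union hRTA, Finset.sum_union hRT]
  have hR : ∑ e ∈ R, sWt (fun z => G.degree z) e ≤ ∑ e ∈ R, sWt (fun z => G'.degree z) e := by
    apply Finset.sum_le_sum
    intro e he
    have hnv : v ∉ e := by
      intro hve
      obtain ⟨z, rfl⟩ := Sym2.mem_iff_exists.1 hve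
      obtain ⟨h1, h2⟩ := Finset.mem_sdiff.1 he
      apply h2
      have h3 : G.Adj v z := by simpa using h1
      rcases (hNv z).1 h3 with rfl | ⟨i, rfl⟩
      · exact Finset.mem_union_left _ (by simp [T])
      · by_cases hi : i = i0
        · subst hi
          exact Finset.mem_union_left _ (by simp [T])
        · exact Finset.mem_union_right _
            (Finset.mem_image.2 ⟨i, Finset.mem_erase.2 ⟨hi, Finset.mem_univ _⟩, rfl⟩)
    induction e with | _ p q => ?_
    apply sWt_le
    · exact hdz' p (by rintro rfl; simp at hnv)
    · exact hdz' q (by rintro rfl; simp at hnv)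
  have hsumT : ∀ f : Sym2 V → ℝ, ∑ e ∈ T, f e = f s(u, w) + f s(v, w) + f s(v, W i0) := by
    intro f
    have k1 := hWw i0
    have k2 := hWu i0
    have k3 := hWv i0
    rw [Finset.sum_insert, Finset.sum_pair, add_assoc]
    · rw [ne_eq, Sym2.eq_iff]
      grind
    · simp only [Finset.mem_insert, Finset.mem_singleton, Sym2.eq_iff]
      grind
  have hsumD : ∀ f : Sym2 V → ℝ, ∑ e ∈ D, f e = ∑ i ∈ Finset.univ.erase i0, f s(v, W i) := by
    intro f
    rw [Finset.sum_image]
    intro i _ j _ h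
    exact hWinj (Sym2.congr_right.1 h)
  have hsumA : ∀ f : Sym2 V → ℝ, ∑ e ∈ A, f e = ∑ i ∈ Finset.univ.erase i0, f s(u, W i) := by
    intro f
    rw [Finset.sum_image]
    intro i _ j _ h
    exact hWinj (Sym2.congr_right.1 h)
  set a := G.degree u with ha
  set b := G.degree v with hb
  have hbR : (3 : ℝ) ≤ b := by exact_mod_cast hdv3
  have habR : (b : ℝ) ≤ a := by exact_mod_cast hduv
  have hau : (a : ℝ) + b - 2 ≤ G'.degree u := by
    have : a + b ≤ G'.degree u + 2 := by omega
    have : (a : ℝ) + b ≤ G'.degree u + 2 := by exact_mod_cast this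
    linarith
  have hvv : (2 : ℝ) ≤ G'.degree v := by exact_mod_cast hdv'
  have hww : (2 : ℝ) ≤ G'.degree w := by
    have := hdz' w hwv'
    rw [hdw] at this
    exact_mod_cast this
  have hWW : ∀ i, (G.degree (W i) : ℝ) ≤ G'.degree (W i) := fun i => by
    exact_mod_cast hdz' _ (hWv i)
  have hDA : ∑ i ∈ Finset.univ.erase i0, sWt (fun z => G.degree z) s(v, W i) +
      ((b : ℝ) - 2) * (√(((a : ℝ) + b - 2) ^ 2 + 2 ^ 2) - √((b : ℝ) ^ 2 + 2 ^ 2)) ≤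
      ∑ i ∈ Finset.univ.erase i0, sWt (fun z => G'.degree z) s(u, W i) := by
    have hcard : ((b : ℝ) - 2) = (Finset.univ.erase i0).card := by
      rw [Finset.card_erase_of_mem (Finset.mem_univ _), Finset.card_univ, Fintype.card_fin,
        Nat.cast_sub (by omega), hdv]
      push_cast
      ring
    rw [hcard, ← nsmul_eq_mul, ← Finset.sum_const, ← Finset.sum_add_distrib]
    apply Finset.sum_le_sum
    intro i _
    rw [sWt_mk, sWt_mk]
    have h2 : (G.degree (W i) : ℝ) ≤ 2 := by exact_mod_cast hdW i
    have g := sqrt_gap_anti (s := b) (t := a + b - 2) (d := G.degree (W i)) (e := 2)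
      (by linarith) (by linarith) (by positivity) h2
    have g' : √(((a : ℝ) + b - 2) ^ 2 + (G.degree (W i) : ℝ) ^ 2) ≤
        √((G'.degree u : ℝ) ^ 2 + (G'.degree (W i) : ℝ) ^ 2) := by
      apply Real.sqrt_le_sqrt
      have := hWW i
      have h0 : (0 : ℝ) ≤ a + b - 2 := by linarith
      gcongr
    rw [← hb]
    linarith
  have hd1 : 1 ≤ G.degree (W i0) := by
    have : 0 < G.degree (W i0) := (G.degree_pos_iff_exists_adj _).2 ⟨v, (hWadj i0).symm⟩
    omega
  have key := sombor_real_ineq a b hdv3 hduv _ hd1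
  have t1 : √(((a : ℝ) + b - 2) ^ 2 + 2 ^ 2) ≤
      √((G'.degree u : ℝ) ^ 2 + (G'.degree w : ℝ) ^ 2) := by
    apply Real.sqrt_le_sqrt
    have h0 : (0 : ℝ) ≤ a + b - 2 := by linarith
    gcongr
  have t2 : √((2 : ℝ) ^ 2 + 2 ^ 2) ≤ √((G'.degree v : ℝ) ^ 2 + (G'.degree w : ℝ) ^ 2) := by
    apply Real.sqrt_le_sqrt
    gcongr
  have t3 : √((2 : ℝ) ^ 2 + (G.degree (W i0) : ℝ) ^ 2) ≤
      √((G'.degree v : ℝ) ^ 2 + (G'.degree (W i0) : ℝ) ^ 2) := by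
    apply Real.sqrt_le_sqrt
    have := hWW i0
    gcongr
  rw [somborIndex_eq G, somborIndex_eq G', hE, hE', hsumT, hsumT, hsumD, hsumA]
  simp only [sWt_mk] at hDA ⊢
  rw [hdw, ← ha, ← hb]
  push_cast
  simp only [← hb] at hDA
  generalize √(((a : ℝ) + b - 2) ^ 2 + 2 ^ 2) = P at *
  generalize √((b : ℝ) ^ 2 + 2 ^ 2) = Q at *
  generalize √((a : ℝ) ^ 2 + 2 ^ 2) = z1 at *
  generalize √((2 : ℝ) ^ 2 + 2 ^ 2) = z2 at *
  generalize √((2 : ℝ) ^ 2 + (G.degree (W i0) : ℝ) ^ 2) = z3 at *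
  linarith
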